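/- arXiv:math/0503029 — 3 statements merged into one kernel-verified Lean document; each statement's English description precedes it below -/
import Mathlib

section
/- The Λ-linear map Δ : B(𝒜,Λ,χ) → A(𝒜,Λ,χ) defined on basis elements by Δ(b_{[I,κ]}) = (ℓ−1)^{−|I|} a^{κ(I)} is a morphism of Λ-algebras: Δ(b_{[∅,∅]}) = a^0 and Δ(b ⋆ b′) = Δ(b) ⋆ Δ(b′) for all b, b′ ∈ B(𝒜,Λ,χ). -/
open Classical Function

noncomputable section

variable {G : Type} [AddCommGroup G] {Λ : Type} [CommRing Λ] [Algebra ℚ Λ]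
  {Ω : Type} [CommRing Ω] [Algebra ℚ Ω]

/-- The "positive cone" `C(𝒜) = C̄(𝒜) ∖ {0}` as a subtype of `K(𝒜)`. -/
abbrev Cpos (Cbar : AddSubmonoid G) : Type := {x : G // x ∈ Cbar ∧ x ≠ 0}
theorem sum_mem_ne_zero {Cbar : AddSubmonoid G}
    (hC : ∀ x ∈ Cbar, ∀ y ∈ Cbar, x + y = 0 → x = 0 ∧ y = 0)
    {ι : Type} (s : Finset ι) (f : ι → G) :
    s.Nonempty → (∀ i ∈ s, f i ∈ Cbar) → (∀ i ∈ s, f i ≠ 0) →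
      (∑ i ∈ s, f i) ∈ Cbar ∧ (∑ i ∈ s, f i) ≠ 0 := by
  induction s using Finset.cons_induction with
  | empty => intro hs _ _; simp at hs
  | cons a s ha ih =>
    intro _ h1 h2
    rw [Finset.sum_cons]
    rcases s.eq_empty_or_nonempty with rfl | hs'
    · simpa using ⟨h1 a (by simp), h2 a (by simp)⟩
    · have ihs := ih hs' (fun i hi => h1 i (Finset.mem_cons_of_mem hi))
        (fun i hi => h2 i (Finset.mem_cons_of_mem hi))
      exact ⟨Cbar.add_mem (h1 a (by simp)) ihs.1,
        fun h0 => h2 a (by simp) ((hC _ (h1 a (by simp)) _ ihs.1 h0).1)⟩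
/-- The sum of two elements of the positive cone `C(𝒜)`. -/
def addC {Cbar : AddSubmonoid G}
    (hC : ∀ x ∈ Cbar, ∀ y ∈ Cbar, x + y = 0 → x = 0 ∧ y = 0)
    (α β : Cpos Cbar) : Cpos Cbar :=
  ⟨(α : G) + (β : G), Cbar.add_mem α.2.1 β.2.1,
    fun h => α.2.2 ((hC _ α.2.1 _ β.2.1 h).1)⟩
/-- A representative `(Fin (card m), κ)` of the equivalence class `[I,κ]`
corresponding to the multiset `m` of elements of `C(𝒜)`. -/
def repF {Cbar : AddSubmonoid G} (m : Multiset (Cpos Cbar)) :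
    Fin (Multiset.card m) → Cpos Cbar :=
  fun i => m.toList.get (Fin.cast (Multiset.length_toList m).symm i)
/-- `|Aut(K,μ)|`, the number of bijections `ι : K → K` with `μ ∘ ι = μ`. -/
def autCard {Cbar : AddSubmonoid G} {n : ℕ} (μ : Fin n → Cpos Cbar) : ℕ :=
  Nat.card {σ : Equiv.Perm (Fin n) // μ ∘ σ = μ}
/-- The coefficient of `b_{[K,μ]}` in `b_{[I,κ]} ⋆ b_{[J,λ]}`, as given by
equation (6.14) of the paper. -/
def coeff614 {Cbar : AddSubmonoid G} (χ : G → G → ℤ) (l u : Λˣ) {a b c : ℕ}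
    (κ : Fin a → Cpos Cbar) (lam : Fin b → Cpos Cbar) (μ : Fin c → Cpos Cbar) : Λ :=
  ((u ^ ((c : ℤ) - (a : ℤ) - (b : ℤ)) : Λˣ) : Λ) *
    algebraMap ℚ Λ ((autCard μ : ℚ))⁻¹ *
    ∑ n ∈ Finset.range (a + b + 1),
      algebraMap ℚ Λ ((-1 : ℚ) ^ (n + c) / (n.factorial : ℚ)) *
        ∑ t ∈ Finset.univ.filter
            (fun t : (Fin a → Fin n) × (Fin b → Fin n) × (Fin n → Fin c) =>
              Function.Surjective (Sum.elim t.1 t.2.1) ∧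
              Function.Surjective t.2.2 ∧
              ∀ k : Fin c,
                (μ k : G) =
                  (∑ i ∈ Finset.univ.filter (fun i : Fin a => t.2.2 (t.1 i) = k),
                    ((κ i : G))) +
                  ∑ j ∈ Finset.univ.filter (fun j : Fin b => t.2.2 (t.2.1 j) = k),
                    ((lam j : G))),
          algebraMap ℚ Λ
              (∏ k : Fin c,
                (((Finset.univ.filter (fun x : Fin n => t.2.2 x = k)).card - 1).factorial : ℚ)) *
            ∏ q ∈ Finset.univ.filter (fun q : Fin a × Fin b => t.1 q.1 = t.2.1 q.2),
              ((l ^ (-χ ((lam q.2 : G)) ((κ q.1 : G))) : Λˣ) : Λ)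
/-- The element `μ(k) = κ(η⁻¹(k)) + λ(ζ⁻¹(k))` of `C(𝒜)` determined by a
surjective map `ρ = η ⊔ ζ : I ⊔ J → K`. -/
def targetμ {Cbar : AddSubmonoid G}
    (hC : ∀ x ∈ Cbar, ∀ y ∈ Cbar, x + y = 0 → x = 0 ∧ y = 0)
    {a b c : ℕ} (κ : Fin a → Cpos Cbar) (lam : Fin b → Cpos Cbar)
    {ρ : Fin a ⊕ Fin b → Fin c} (hρ : Function.Surjective ρ) (k : Fin c) :
    Cpos Cbar :=
  ⟨∑ x ∈ Finset.univ.filter (fun x => ρ x = k),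
      Sum.elim (fun i => ((κ i : G))) (fun j => ((lam j : G))) x,
    sum_mem_ne_zero hC (Finset.univ.filter (fun x => ρ x = k))
      (Sum.elim (fun i => ((κ i : G))) (fun j => ((lam j : G))))
      (by obtain ⟨x, hx⟩ := hρ k; exact ⟨x, by simp [hx]⟩)
      (by rintro (i | j) _
          · exact (κ i).2.1
          · exact (lam j).2.1)
      (by rintro (i | j) _
          · exact (κ i).2.2
          · exact (lam j).2.2)⟩
/-- The finite set of all equivalence classes `[K,μ]` (encoded as multisets) which can
occur in the product `b_{[I,κ]} ⋆ b_{[J,λ]}`. -/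
def candidatesB {Cbar : AddSubmonoid G}
    (hC : ∀ x ∈ Cbar, ∀ y ∈ Cbar, x + y = 0 → x = 0 ∧ y = 0)
    {a b : ℕ} (κ : Fin a → Cpos Cbar) (lam : Fin b → Cpos Cbar) :
    Finset (Multiset (Cpos Cbar)) :=
  (Finset.range (a + b + 1)).biUnion fun c =>
    Finset.image
      (fun ρ : {ρ : Fin a ⊕ Fin b → Fin c // Function.Surjective ρ} =>
        Multiset.map (targetμ hC κ lam ρ.2) Finset.univ.val)
      Finset.univ
/-- The multiplication `⋆` of equation (6.14) on `B(𝒜,Λ,χ)`, the free `Λ`-module with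
basis `b_{[I,κ]}` indexed by the equivalence classes `[I,κ]` (equivalently, by finite
multisets of elements of `C(𝒜)`). -/
def mulB {Cbar : AddSubmonoid G} (χ : G → G → ℤ) (l u : Λˣ)
    (hC : ∀ x ∈ Cbar, ∀ y ∈ Cbar, x + y = 0 → x = 0 ∧ y = 0)
    (f g : Multiset (Cpos Cbar) →₀ Λ) : Multiset (Cpos Cbar) →₀ Λ :=
  f.sum fun m₁ x =>
    g.sum fun m₂ y =>
      ∑ m₃ ∈ candidatesB hC (repF m₁) (repF m₂),
        Finsupp.single m₃ (x * y * coeff614 χ l u (repF m₁) (repF m₂) (repF m₃))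
/-- `κ(I) = ∑_{i ∈ I} κ(i)` as an element of `C̄(𝒜)`, for the class `[I,κ]`
corresponding to a multiset `m`. -/
def sumCbar {Cbar : AddSubmonoid G} (m : Multiset (Cpos Cbar)) : ↥Cbar :=
  ⟨(m.map (Subtype.val : Cpos Cbar → G)).sum,
    AddSubmonoid.multiset_sum_mem Cbar _ (by
      intro a ha
      obtain ⟨x, _, h⟩ := Multiset.mem_map.mp ha
      exact h ▸ x.2.1)⟩
/-- The `Λ`-linear map `Δ : B(𝒜,Λ,χ) → A(𝒜,Λ,χ)`, defined on basis elements by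
`Δ(b_{[I,κ]}) = (ℓ-1)^{-|I|} a^{κ(I)}`. -/
def deltaMap {Cbar : AddSubmonoid G} (u : Λˣ)
    (f : Multiset (Cpos Cbar) →₀ Λ) : ↥Cbar →₀ Λ :=
  f.sum fun m x =>
    Finsupp.single (sumCbar m) (x * ((u⁻¹ ^ Multiset.card m : Λˣ) : Λ))
/-- Multiplication `⋆` on `A(𝒜,Λ,χ)`, the free `Λ`-module with basis `a^α` for
`α ∈ C̄(𝒜)`, determined on basis elements by `a^α ⋆ a^β = ℓ^{-χ(β,α)} a^{α+β}`
and extended `Λ`-bilinearly. -/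
def mulA (Cbar : AddSubmonoid G) (χ : G → G → ℤ) (l : Λˣ)
    (f g : ↥Cbar →₀ Λ) : ↥Cbar →₀ Λ :=
  f.sum fun α x => g.sum fun β y =>
    Finsupp.single (α + β) (x * y * ((l ^ (-χ (β : G) (α : G)) : Λˣ) : Λ))

/-- The number of cyclic orders on a set with `m` elements, taken to be `0` for `m = 0`. -/
def cycleWeight : ℕ → ℚ
  | 0 => 0
  | m + 1 => m.factorial

theorem cycleWeight_succ (m : ℕ) :
    cycleWeight (m + 1) = m * cycleWeight m + if m = 0 then 1 else 0 := by
  cases m with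
  | zero => simp [cycleWeight]
  | succ m => simp [cycleWeight, Nat.factorial_succ]

/-- The number of maps `Fin n → Fin c` together with a cyclic order on every fibre, all fibres
being nonempty. -/
def fiberSum (n c : ℕ) : ℚ :=
  ∑ θ : Fin n → Fin c, ∏ k, cycleWeight (Finset.univ.filter (fun x => θ x = k)).card

theorem card_filter_cons {n c : ℕ} (j : Fin c) (θ : Fin n → Fin c) (k : Fin c) :
    (Finset.univ.filter (fun x => (Fin.cons j θ : Fin (n + 1) → Fin c) x = k)).card =
      (Finset.univ.filter (fun x => θ x = k)).card + if j = k then 1 else 0 := by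
  rw [Fin.card_filter_univ_succ]
  split_ifs <;> simp_all

theorem sum_missing {n c : ℕ} (k : Fin (c + 1)) :
    ∑ θ : Fin n → Fin (c + 1),
      (if (Finset.univ.filter (fun x => θ x = k)).card = 0 then (1 : ℚ) else 0) *
        ∏ j, cycleWeight (Finset.univ.filter (fun x => θ x = k.succAbove j)).card =
      fiberSum n c := by
  symm
  refine Finset.sum_of_injOn (fun θ x => k.succAbove (θ x)) ?_ (by simp) ?_ ?_
  · intro θ _ θ' _ h
    funext x
    exact Fin.succAbove_right_injective (congrFun h x)
  · intro θ _ h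
    rw [if_neg, zero_mul]
    intro h0
    rw [Finset.card_eq_zero, Finset.filter_eq_empty_iff] at h0
    choose η hη using fun x => Fin.exists_succAbove_eq (h0 (Finset.mem_univ x))
    exact h ⟨η, by simp, funext hη⟩
  · intro θ _
    simp [Fin.succAbove_ne, Fin.succAbove_right_injective.eq_iff]

theorem fiberSum_succ_succ (n c : ℕ) :
    fiberSum (n + 1) (c + 1) = n * fiberSum n (c + 1) + (c + 1) * fiberSum n c := by
  have key (k : Fin (c + 1)) (θ : Fin n → Fin (c + 1)) :
      ∏ j, cycleWeight
        (Finset.univ.filter (fun x => (Fin.cons k θ : Fin (n + 1) → Fin (c + 1)) x = j)).card =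
      ((Finset.univ.filter (fun x => θ x = k)).card : ℚ) *
          ∏ j, cycleWeight (Finset.univ.filter (fun x => θ x = j)).card +
        (if (Finset.univ.filter (fun x => θ x = k)).card = 0 then (1 : ℚ) else 0) *
          ∏ j, cycleWeight (Finset.univ.filter (fun x => θ x = k.succAbove j)).card := by
    rw [Fin.prod_univ_succAbove _ k, Fin.prod_univ_succAbove _ k]
    simp only [card_filter_cons, (Fin.succAbove_ne k _).symm, if_true, if_false, add_zero,
      cycleWeight_succ]
    ring
  have hcard (θ : Fin n → Fin (c + 1)) :
      ∑ k, ((Finset.univ.filter (fun x => θ x = k)).card : ℚ) = n := by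
    have := Finset.card_eq_sum_card_fiberwise (s := Finset.univ) (t := Finset.univ) (f := θ)
      (by simp)
    rw [← Nat.cast_sum, ← this]
    simp
  unfold fiberSum
  rw [← Fintype.sum_equiv (Fin.consEquiv (fun _ => Fin (c + 1))) _ _ (fun _ => rfl),
    Fintype.sum_prod_type]
  simp only [Fin.consEquiv_apply, key, Finset.sum_add_distrib, sum_missing]
  rw [Finset.sum_comm]
  simp only [← Finset.sum_mul, hcard, ← Finset.mul_sum]
  simp [fiberSum]

theorem fiberSum_zero_zero : fiberSum 0 0 = 1 := by simp [fiberSum]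

theorem fiberSum_succ_zero (n : ℕ) : fiberSum (n + 1) 0 = 0 := by
  simp [fiberSum]

theorem fiberSum_eq_zero_of_lt {n c : ℕ} (h : n < c) : fiberSum n c = 0 := by
  induction n generalizing c with
  | zero =>
    obtain ⟨c, rfl⟩ := Nat.exists_eq_succ_of_ne_zero h.ne'
    simp [fiberSum, cycleWeight]
  | succ n ih =>
    obtain ⟨c, rfl⟩ := Nat.exists_eq_succ_of_ne_zero (Nat.ne_zero_of_lt h)
    rw [Nat.succ_eq_add_one, fiberSum_succ_succ, ih (by omega), ih (by omega)]
    ring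

theorem alternating_sum_fiberSum_succ {n N : ℕ} (h : n ≤ N) :
    ∑ c ∈ Finset.range (N + 1 + 1), (-1 : ℚ) ^ c / c.factorial * fiberSum (n + 1) c =
      (n - 1) * ∑ c ∈ Finset.range (N + 1), (-1 : ℚ) ^ c / c.factorial * fiberSum n c := by
  have hterm (c : ℕ) : (-1 : ℚ) ^ (c + 1) / (c + 1).factorial * fiberSum (n + 1) (c + 1) =
      n * ((-1 : ℚ) ^ (c + 1) / (c + 1).factorial * fiberSum n (c + 1)) -
        (-1 : ℚ) ^ c / c.factorial * fiberSum n c := by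
    rw [fiberSum_succ_succ, Nat.factorial_succ]
    have := Nat.factorial_ne_zero c
    push_cast
    field_simp
    ring
  have hzero : (n : ℚ) * fiberSum n 0 = 0 := by
    cases n <;> simp [fiberSum_succ_zero]
  have hshift := Finset.sum_range_succ' (fun c => (-1 : ℚ) ^ c / c.factorial * fiberSum n c) (N + 1)
  rw [Finset.sum_range_succ, fiberSum_eq_zero_of_lt (c := N + 1) (by omega)] at hshift
  rw [Finset.sum_range_succ', fiberSum_succ_zero]
  simp only [hterm, Finset.sum_sub_distrib, ← Finset.mul_sum]
  simp only [pow_zero, Nat.factorial_zero, Nat.cast_one, div_one, one_mul, mul_zero, add_zero]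
    at hshift ⊢
  linear_combination (-(n : ℚ)) * hshift - hzero

theorem alternating_sum_fiberSum {n N : ℕ} (h : n ≤ N) :
    ∑ c ∈ Finset.range (N + 1), (-1 : ℚ) ^ (n + c) / c.factorial * fiberSum n c =
      if n ≤ 1 then 1 else 0 := by
  simp only [pow_add, mul_div_assoc, mul_assoc, ← Finset.mul_sum]
  induction n generalizing N with
  | zero =>
    rw [Finset.sum_range_succ', Finset.sum_eq_zero]
    · simp [fiberSum_zero_zero]
    · intro c _
      rw [fiberSum_eq_zero_of_lt (by omega), mul_zero]
  | succ n ih =>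
    obtain ⟨N, rfl⟩ := Nat.exists_eq_succ_of_ne_zero (Nat.ne_zero_of_lt h)
    rw [alternating_sum_fiberSum_succ (by omega), pow_succ]
    have := ih (N := N) (by omega)
    have h2 : (1 - (n : ℚ)) * (if n ≤ 1 then 1 else 0) = if n + 1 ≤ 1 then 1 else 0 := by
      rcases n with _ | _ | n <;> simp
    rw [← h2, ← this]
    ring

theorem exists_perm_comp_eq {α : Type} {c : ℕ} {f g : Fin c → α}
    (h : Multiset.map f Finset.univ.val = Multiset.map g Finset.univ.val) :
    ∃ σ : Equiv.Perm (Fin c), f ∘ σ = g := by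
  have hcard (a : α) : Nonempty ({x // g x = a} ≃ {x // f x = a}) := by
    refine ⟨Fintype.equivOfCardEq ?_⟩
    have := congrArg (Multiset.count a) h
    rw [Multiset.count_map, Multiset.count_map] at this
    simp only [Fintype.card_subtype, eq_comm (b := a)]
    exact this.symm
  refine ⟨(Equiv.sigmaFiberEquiv g).symm.trans
    ((Equiv.sigmaCongrRight fun a => (hcard a).some).trans (Equiv.sigmaFiberEquiv f)), ?_⟩
  funext x
  exact ((hcard (g x)).some ⟨x, rfl⟩).2

theorem map_comp_perm_univ {α : Type} {c : ℕ} (f : Fin c → α) (σ : Equiv.Perm (Fin c)) :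
    Multiset.map (f ∘ σ) Finset.univ.val = Multiset.map f Finset.univ.val := by
  rw [← Multiset.map_map, Multiset.map_univ_val_equiv]

theorem card_perm_comp_eq {α : Type} {c : ℕ} {f g : Fin c → α}
    (h : Multiset.map f Finset.univ.val = Multiset.map g Finset.univ.val) :
    Nat.card {σ : Equiv.Perm (Fin c) // f ∘ σ = g} =
      Nat.card {σ : Equiv.Perm (Fin c) // g ∘ σ = g} := by
  obtain ⟨σ₀, rfl⟩ := exists_perm_comp_eq h
  refine Nat.card_congr ((Equiv.mulLeft σ₀⁻¹).subtypeEquiv fun σ => ?_)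
  simp [Function.comp_assoc, ← Equiv.Perm.coe_mul]

theorem autCard_mul_sum {α T R : Type} [CommRing R] [Fintype T] {c : ℕ} (ν : Fin c → α)
    (τ : T → Fin c → α)
    (F : T → R) (e : Equiv.Perm (Fin c) → Equiv.Perm T) (hF : ∀ σ t, F (e σ t) = F t)
    (hτ : ∀ σ t, τ (e σ t) = τ t ∘ σ) :
    (Nat.card {σ : Equiv.Perm (Fin c) // ν ∘ σ = ν} : R) *
        ∑ t ∈ Finset.univ.filter
          (fun t => Multiset.map (τ t) Finset.univ.val = Multiset.map ν Finset.univ.val), F t =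
      (c.factorial : R) * ∑ t ∈ Finset.univ.filter (fun t => τ t = ν), F t := by
  have hσ (σ : Equiv.Perm (Fin c)) :
      ∑ t ∈ Finset.univ.filter (fun t => τ t = ν), F t =
        ∑ t, if τ t ∘ σ = ν then F t else 0 := by
    rw [Finset.sum_filter, ← Equiv.sum_comp (e σ)]
    simp only [hF, hτ]
  have hcard : (c.factorial : R) = ∑ _σ : Equiv.Perm (Fin c), 1 := by
    simp [Fintype.card_perm]
  rw [hcard, Finset.sum_mul]
  simp only [one_mul]
  rw [Finset.sum_congr rfl (fun σ _ => hσ σ), Finset.sum_comm, Finset.mul_sum, Finset.sum_filter]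
  refine Finset.sum_congr rfl fun t _ => ?_
  rw [← Finset.sum_filter, Finset.sum_const, nsmul_eq_mul]
  split_ifs with h
  · rw [← card_perm_comp_eq h, Nat.card_eq_fintype_card, Fintype.card_subtype]
  · rw [Finset.filter_eq_empty_iff.mpr]
    · simp
    · rintro σ - rfl
      exact h (map_comp_perm_univ _ σ).symm

/-- The product of the twists `ℓ^{-χ(λ(j),κ(i))}` over the pairs with `φ(i) = ψ(j)`. -/
def twist {Cbar : AddSubmonoid G} (χ : G → G → ℤ) (l : Λˣ) {a b n : ℕ}
    (κ : Fin a → Cpos Cbar) (lam : Fin b → Cpos Cbar) (φ : Fin a → Fin n) (ψ : Fin b → Fin n) :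
    Λ :=
  ∏ q ∈ Finset.univ.filter (fun q : Fin a × Fin b => φ q.1 = ψ q.2),
    ((l ^ (-χ ((lam q.2 : G)) ((κ q.1 : G))) : Λˣ) : Λ)

/-- The class `k ↦ κ((θ∘φ)⁻¹(k)) + λ((θ∘ψ)⁻¹(k))` of a triple `(φ,ψ,θ)`. -/
def tripleClass {Cbar : AddSubmonoid G} {a b n c : ℕ}
    (κ : Fin a → Cpos Cbar) (lam : Fin b → Cpos Cbar)
    (t : (Fin a → Fin n) × (Fin b → Fin n) × (Fin n → Fin c)) (k : Fin c) : G :=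
  (∑ i ∈ Finset.univ.filter (fun i : Fin a => t.2.2 (t.1 i) = k), ((κ i : G))) +
    ∑ j ∈ Finset.univ.filter (fun j : Fin b => t.2.2 (t.2.1 j) = k), ((lam j : G))

/-- The contribution of a triple `(φ,ψ,θ)` to the structure constants, extended by zero to
triples which are not surjective. -/
def tripleWeight {Cbar : AddSubmonoid G} (χ : G → G → ℤ) (l : Λˣ) {a b n c : ℕ}
    (κ : Fin a → Cpos Cbar) (lam : Fin b → Cpos Cbar)
    (t : (Fin a → Fin n) × (Fin b → Fin n) × (Fin n → Fin c)) : Λ :=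
  if Function.Surjective (Sum.elim t.1 t.2.1) ∧ Function.Surjective t.2.2 then
    algebraMap ℚ Λ
        (∏ k : Fin c,
          (((Finset.univ.filter (fun x : Fin n => t.2.2 x = k)).card - 1).factorial : ℚ)) *
      twist χ l κ lam t.1 t.2.1
  else 0

/-- Relabelling the target of `θ` in a triple `(φ,ψ,θ)`. -/
def relabel (a b n : ℕ) {c : ℕ} (σ : Equiv.Perm (Fin c)) :
    Equiv.Perm ((Fin a → Fin n) × (Fin b → Fin n) × (Fin n → Fin c)) :=
  Equiv.prodCongrRight fun _ => Equiv.prodCongrRight fun _ => Equiv.arrowCongr (Equiv.refl _) σ.symm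

theorem relabel_apply {a b n c : ℕ} (σ : Equiv.Perm (Fin c))
    (t : (Fin a → Fin n) × (Fin b → Fin n) × (Fin n → Fin c)) :
    relabel a b n σ t = (t.1, t.2.1, σ.symm ∘ t.2.2) := rfl

theorem tripleClass_relabel {Cbar : AddSubmonoid G} {a b n c : ℕ}
    (κ : Fin a → Cpos Cbar) (lam : Fin b → Cpos Cbar) (σ : Equiv.Perm (Fin c))
    (t : (Fin a → Fin n) × (Fin b → Fin n) × (Fin n → Fin c)) :
    tripleClass κ lam (relabel a b n σ t) = tripleClass κ lam t ∘ σ := by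
  funext k
  simp [tripleClass, relabel_apply, Equiv.symm_apply_eq]

theorem tripleWeight_relabel {Cbar : AddSubmonoid G} (χ : G → G → ℤ) (l : Λˣ) {a b n c : ℕ}
    (κ : Fin a → Cpos Cbar) (lam : Fin b → Cpos Cbar) (σ : Equiv.Perm (Fin c))
    (t : (Fin a → Fin n) × (Fin b → Fin n) × (Fin n → Fin c)) :
    tripleWeight χ l κ lam (relabel a b n σ t) = tripleWeight χ l κ lam t := by
  have hprod : (∏ k : Fin c, (((Finset.univ.filter
      (fun x : Fin n => σ.symm (t.2.2 x) = k)).card - 1).factorial : ℚ)) =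
      ∏ k : Fin c,
        (((Finset.univ.filter (fun x : Fin n => t.2.2 x = k)).card - 1).factorial : ℚ) := by
    rw [← Equiv.prod_comp σ
      (fun k => (((Finset.univ.filter (fun x : Fin n => t.2.2 x = k)).card - 1).factorial : ℚ))]
    simp only [Equiv.symm_apply_eq]
  simp only [tripleWeight, relabel_apply, Function.comp_apply, Equiv.comp_surjective]
  congr! 3

theorem map_repF {Cbar : AddSubmonoid G} (m : Multiset (Cpos Cbar)) :
    Multiset.map (repF m) Finset.univ.val = m := by
  have h := Multiset.map_univ_val_equiv (finCongr (Multiset.length_toList m).symm)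
  conv_rhs => rw [← Multiset.coe_toList m, ← List.ofFn_get m.toList, ← Fin.univ_val_map, ← h,
    Multiset.map_map]
  rfl

theorem map_val_repF {Cbar : AddSubmonoid G} (m : Multiset (Cpos Cbar)) :
    Multiset.map (fun k => (repF m k : G)) Finset.univ.val =
      m.map (Subtype.val : Cpos Cbar → G) := by
  conv_rhs => rw [← map_repF m]
  rw [Multiset.map_map]
  rfl

theorem coeff614_repF {Cbar : AddSubmonoid G} (χ : G → G → ℤ) (l u : Λˣ) {a b : ℕ}
    (κ : Fin a → Cpos Cbar) (lam : Fin b → Cpos Cbar) (m : Multiset (Cpos Cbar)) :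
    coeff614 χ l u κ lam (repF m) =
      ((u ^ ((m.card : ℤ) - (a : ℤ) - (b : ℤ)) : Λˣ) : Λ) *
        ∑ n ∈ Finset.range (a + b + 1),
          algebraMap ℚ Λ ((-1 : ℚ) ^ (n + m.card) / (n.factorial : ℚ) / (m.card.factorial : ℚ)) *
            ∑ t : (Fin a → Fin n) × (Fin b → Fin n) × (Fin n → Fin m.card),
              if Multiset.map (tripleClass κ lam t) Finset.univ.val =
                  m.map (Subtype.val : Cpos Cbar → G) then
                tripleWeight χ l κ lam t else 0 := by
  unfold coeff614
  rw [mul_assoc, Finset.mul_sum]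
  congr 1
  refine Finset.sum_congr rfl fun n _ => ?_
  have hsum := autCard_mul_sum (fun k => (repF m k : G))
    (tripleClass (n := n) κ lam) (tripleWeight χ l κ lam) (relabel a b n)
    (tripleWeight_relabel χ l κ lam) (tripleClass_relabel κ lam)
  have haut : Nat.card {σ : Equiv.Perm (Fin m.card) //
      (fun k => (repF m k : G)) ∘ σ = fun k => (repF m k : G)} = autCard (repF m) := by
    refine Nat.card_congr (Equiv.subtypeEquivRight fun σ => ?_)
    simp [funext_iff, Subtype.ext_iff]
  have hpos : (autCard (repF m) : ℚ) ≠ 0 := by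
    have : Nonempty {σ : Equiv.Perm (Fin m.card) // repF m ∘ σ = repF m} := ⟨1, rfl⟩
    exact_mod_cast (Nat.card_pos (α := {σ : Equiv.Perm (Fin m.card) // repF m ∘ σ = repF m})).ne'
  have hfac : (m.card.factorial : ℚ) ≠ 0 := by exact_mod_cast Nat.factorial_ne_zero _
  rw [haut, map_val_repF, Finset.sum_filter] at hsum
  have hfilter : (∑ t ∈ Finset.univ.filter
        (fun t => tripleClass (n := n) κ lam t = fun k => (repF m k : G)),
        tripleWeight χ l κ lam t) = ∑ t ∈ Finset.univ.filter
            (fun t : (Fin a → Fin n) × (Fin b → Fin n) × (Fin n → Fin m.card) =>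
              Function.Surjective (Sum.elim t.1 t.2.1) ∧
              Function.Surjective t.2.2 ∧
              ∀ k : Fin m.card,
                (repF m k : G) =
                  (∑ i ∈ Finset.univ.filter (fun i : Fin a => t.2.2 (t.1 i) = k),
                    ((κ i : G))) +
                  ∑ j ∈ Finset.univ.filter (fun j : Fin b => t.2.2 (t.2.1 j) = k),
                    ((lam j : G))),
          algebraMap ℚ Λ
              (∏ k : Fin m.card,
                (((Finset.univ.filter (fun x : Fin n => t.2.2 x = k)).card - 1).factorial : ℚ)) *
            ∏ q ∈ Finset.univ.filter (fun q : Fin a × Fin b => t.1 q.1 = t.2.1 q.2),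
              ((l ^ (-χ ((lam q.2 : G)) ((κ q.1 : G))) : Λˣ) : Λ) := by
    rw [Finset.sum_filter, Finset.sum_filter]
    refine Finset.sum_congr rfl fun t _ => ?_
    rw [tripleWeight, ← ite_and]
    refine if_congr ?_ rfl rfl
    rw [funext_iff, and_comm, and_assoc]
    simp only [tripleClass, eq_comm]
  rw [← hfilter]
  have hunit : (autCard (repF m) : Λ) * algebraMap ℚ Λ (autCard (repF m) : ℚ)⁻¹ = 1 := by
    rw [← map_natCast (algebraMap ℚ Λ), ← map_mul, mul_inv_cancel₀ hpos, map_one]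
  have hunit' : (m.card.factorial : Λ) * algebraMap ℚ Λ (m.card.factorial : ℚ)⁻¹ = 1 := by
    rw [← map_natCast (algebraMap ℚ Λ), ← map_mul, mul_inv_cancel₀ hfac, map_one]
  rw [div_eq_mul_inv _ (m.card.factorial : ℚ), map_mul]
  set A := algebraMap ℚ Λ (autCard (repF m) : ℚ)⁻¹
  set B := algebraMap ℚ Λ (m.card.factorial : ℚ)⁻¹
  set D := algebraMap ℚ Λ ((-1 : ℚ) ^ (n + m.card) / (n.factorial : ℚ))
  set S := ∑ t ∈ Finset.univ.filter
        (fun t => tripleClass (n := n) κ lam t = fun k => (repF m k : G)), tripleWeight χ l κ lam t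
  set S' := ∑ t : (Fin a → Fin n) × (Fin b → Fin n) × (Fin n → Fin m.card),
              if Multiset.map (tripleClass κ lam t) Finset.univ.val =
                  m.map (Subtype.val : Cpos Cbar → G) then
                tripleWeight χ l κ lam t else 0
  linear_combination (-A * B * D) * hsum - A * D * S * hunit' + B * D * S' * hunit

theorem map_val_targetμ {Cbar : AddSubmonoid G}
    (hC : ∀ x ∈ Cbar, ∀ y ∈ Cbar, x + y = 0 → x = 0 ∧ y = 0) {a b n c : ℕ}
    (κ : Fin a → Cpos Cbar) (lam : Fin b → Cpos Cbar)
    (t : (Fin a → Fin n) × (Fin b → Fin n) × (Fin n → Fin c))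
    (hρ : Function.Surjective (t.2.2 ∘ Sum.elim t.1 t.2.1)) :
    Multiset.map (Subtype.val : Cpos Cbar → G)
        (Multiset.map (targetμ hC κ lam hρ) Finset.univ.val) =
      Multiset.map (tripleClass κ lam t) Finset.univ.val := by
  rw [Multiset.map_map]
  refine Multiset.map_congr rfl fun k _ => ?_
  simp only [targetμ, tripleClass, Finset.sum_filter, Fintype.sum_sum_type, Function.comp_apply,
    Sum.elim_inl, Sum.elim_inr]
  congr!

theorem card_le_of_surjective_sum {a b c : ℕ} {ρ : Fin a ⊕ Fin b → Fin c}
    (hρ : Function.Surjective ρ) : c ≤ a + b := by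
  simpa using Fintype.card_le_of_surjective ρ hρ

theorem mem_candidatesB {Cbar : AddSubmonoid G}
    (hC : ∀ x ∈ Cbar, ∀ y ∈ Cbar, x + y = 0 → x = 0 ∧ y = 0) {a b : ℕ}
    {κ : Fin a → Cpos Cbar} {lam : Fin b → Cpos Cbar} {m : Multiset (Cpos Cbar)} :
    m ∈ candidatesB hC κ lam ↔
      ∃ (c : ℕ) (ρ : Fin a ⊕ Fin b → Fin c) (hρ : Function.Surjective ρ),
        Multiset.map (targetμ hC κ lam hρ) Finset.univ.val = m := by
  simp only [candidatesB, Finset.mem_biUnion, Finset.mem_image, Finset.mem_univ, true_and,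
    Subtype.exists, Finset.mem_range]
  constructor
  · rintro ⟨c, -, ρ, hρ, h⟩
    exact ⟨c, ρ, hρ, h⟩
  · rintro ⟨c, ρ, hρ, h⟩
    exact ⟨c, Nat.lt_succ_of_le (card_le_of_surjective_sum hρ), ρ, hρ, h⟩

theorem card_le_of_mem_candidatesB {Cbar : AddSubmonoid G}
    (hC : ∀ x ∈ Cbar, ∀ y ∈ Cbar, x + y = 0 → x = 0 ∧ y = 0) {a b : ℕ}
    {κ : Fin a → Cpos Cbar} {lam : Fin b → Cpos Cbar} {m : Multiset (Cpos Cbar)}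
    (hm : m ∈ candidatesB hC κ lam) : m.card ≤ a + b := by
  obtain ⟨c, ρ, hρ, rfl⟩ := (mem_candidatesB hC).mp hm
  simpa using card_le_of_surjective_sum hρ

theorem sum_candidatesB {Cbar : AddSubmonoid G}
    (hC : ∀ x ∈ Cbar, ∀ y ∈ Cbar, x + y = 0 → x = 0 ∧ y = 0) (χ : G → G → ℤ) (l : Λˣ)
    {a b n c : ℕ} (κ : Fin a → Cpos Cbar) (lam : Fin b → Cpos Cbar)
    (t : (Fin a → Fin n) × (Fin b → Fin n) × (Fin n → Fin c)) :
    (∑ m ∈ candidatesB hC κ lam,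
      if Multiset.map (tripleClass κ lam t) Finset.univ.val =
          m.map (Subtype.val : Cpos Cbar → G) then
        tripleWeight χ l κ lam t else 0) = tripleWeight χ l κ lam t := by
  by_cases ht : Function.Surjective (Sum.elim t.1 t.2.1) ∧ Function.Surjective t.2.2
  · have hρ := ht.2.comp ht.1
    have h (m : Multiset (Cpos Cbar)) : Multiset.map (tripleClass κ lam t) Finset.univ.val =
        m.map (Subtype.val : Cpos Cbar → G) ↔
        Multiset.map (targetμ hC κ lam hρ) Finset.univ.val = m := by
      rw [← map_val_targetμ hC κ lam t hρ,
        (Multiset.map_injective Subtype.val_injective).eq_iff]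
    simp only [h]
    rw [Finset.sum_ite_eq, if_pos]
    exact (mem_candidatesB hC).mpr ⟨c, _, hρ, rfl⟩
  · simp [tripleWeight, ht]

theorem fiberSum_eq_sum_factorial (n c : ℕ) :
    fiberSum n c = ∑ θ : Fin n → Fin c, if Function.Surjective θ then
      ∏ k, (((Finset.univ.filter (fun x => θ x = k)).card - 1).factorial : ℚ) else 0 := by
  refine Finset.sum_congr rfl fun θ _ => ?_
  split_ifs with h
  · refine Finset.prod_congr rfl fun k _ => ?_
    obtain ⟨x, hx⟩ := h k
    have : (Finset.univ.filter (fun x => θ x = k)).card ≠ 0 :=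
      Finset.card_ne_zero_of_mem (a := x) (by simp [hx])
    obtain ⟨j, hj⟩ := Nat.exists_eq_succ_of_ne_zero this
    simp [hj, cycleWeight]
  · rw [Function.Surjective] at h
    push Not at h
    obtain ⟨k, hk⟩ := h
    refine Finset.prod_eq_zero (Finset.mem_univ k) ?_
    rw [Finset.filter_false_of_mem (by simpa using hk)]
    rfl

theorem sum_tripleWeight {Cbar : AddSubmonoid G} (χ : G → G → ℤ) (l : Λˣ) {a b : ℕ} (n c : ℕ)
    (κ : Fin a → Cpos Cbar) (lam : Fin b → Cpos Cbar) :
    ∑ t : (Fin a → Fin n) × (Fin b → Fin n) × (Fin n → Fin c), tripleWeight χ l κ lam t =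
      algebraMap ℚ Λ (fiberSum n c) *
        ∑ p : (Fin a → Fin n) × (Fin b → Fin n),
          if Function.Surjective (Sum.elim p.1 p.2) then twist χ l κ lam p.1 p.2 else 0 := by
  rw [fiberSum_eq_sum_factorial, map_sum, Finset.sum_mul_sum, Finset.sum_comm,
    ← (Equiv.prodAssoc _ _ _).sum_comp, Fintype.sum_prod_type]
  refine Finset.sum_congr rfl fun p _ => Finset.sum_congr rfl fun θ _ => ?_
  simp only [tripleWeight, Equiv.prodAssoc_apply]
  by_cases hp : Function.Surjective (Sum.elim p.1 p.2) <;>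
    by_cases hθ : Function.Surjective θ <;> simp [hp, hθ]

theorem sum_coefficients {Cbar : AddSubmonoid G} (χ : G → G → ℤ) (l : Λˣ) {a b : ℕ}
    (κ : Fin a → Cpos Cbar) (lam : Fin b → Cpos Cbar) :
    ∑ c ∈ Finset.range (a + b + 1), ∑ n ∈ Finset.range (a + b + 1),
      algebraMap ℚ Λ ((-1 : ℚ) ^ (n + c) / (n.factorial : ℚ) / (c.factorial : ℚ)) *
        ∑ t : (Fin a → Fin n) × (Fin b → Fin n) × (Fin n → Fin c), tripleWeight χ l κ lam t =
    ∏ q : Fin a × Fin b, ((l ^ (-χ ((lam q.2 : G)) ((κ q.1 : G))) : Λˣ) : Λ) := by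
  have hn (n : ℕ) (h : n ∈ Finset.range (a + b + 1)) :
      ∑ c ∈ Finset.range (a + b + 1),
        algebraMap ℚ Λ ((-1 : ℚ) ^ (n + c) / (n.factorial : ℚ) / (c.factorial : ℚ)) *
        ∑ t : (Fin a → Fin n) × (Fin b → Fin n) × (Fin n → Fin c), tripleWeight χ l κ lam t =
      if n ≤ 1 then ∑ p : (Fin a → Fin n) × (Fin b → Fin n),
          if Function.Surjective (Sum.elim p.1 p.2) then twist χ l κ lam p.1 p.2 else 0
      else 0 := by
    have hs := alternating_sum_fiberSum (n := n) (N := a + b)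
      (Nat.lt_succ_iff.mp (Finset.mem_range.mp h))
    simp only [sum_tripleWeight, ← mul_assoc, ← map_mul, ← Finset.sum_mul, ← map_sum]
    have : ∑ c ∈ Finset.range (a + b + 1),
        (-1 : ℚ) ^ (n + c) / (n.factorial : ℚ) / (c.factorial : ℚ) * fiberSum n c =
        (n.factorial : ℚ)⁻¹ * if n ≤ 1 then 1 else 0 := by
      rw [← hs, Finset.mul_sum]
      refine Finset.sum_congr rfl fun c _ => ?_
      ring
    rw [this]
    rcases n with _ | _ | n <;> simp
  rw [Finset.sum_comm, Finset.sum_congr rfl hn]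
  rcases Nat.eq_zero_or_pos (a + b) with h0 | hpos
  · obtain ⟨rfl, rfl⟩ : a = 0 ∧ b = 0 := by omega
    have hsurj (p : (Fin 0 → Fin 0) × (Fin 0 → Fin 0)) :
      Function.Surjective (Sum.elim p.1 p.2) := fun x => x.elim0
    simp [twist, hsurj]
  · have hempty : IsEmpty ((Fin a → Fin 0) × (Fin b → Fin 0)) := by
      refine ⟨fun p => ?_⟩
      rcases Nat.eq_zero_or_pos a with rfl | ha
      · exact (p.2 ⟨0, by omega⟩).elim0
      · exact (p.1 ⟨0, ha⟩).elim0
    have hsurj (p : (Fin a → Fin 1) × (Fin b → Fin 1)) :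
        Function.Surjective (Sum.elim p.1 p.2) := by
      have : Nonempty (Fin a ⊕ Fin b) := by
        rcases Nat.eq_zero_or_pos a with rfl | ha
        · exact ⟨Sum.inr ⟨0, by omega⟩⟩
        · exact ⟨Sum.inl ⟨0, ha⟩⟩
      exact Function.surjective_to_subsingleton _
    rw [Finset.sum_eq_single_of_mem 1 (by simp; omega)]
    · simp [twist, hsurj, Subsingleton.elim _ (0 : Fin 1)]
    · intro n _ hn1
      rcases n with _ | _ | n
      · rw [Finset.univ_eq_empty, Finset.sum_empty, ite_self]
      · exact absurd rfl hn1
      · exact if_neg (by omega)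

theorem sum_coeff614 {Cbar : AddSubmonoid G}
    (hC : ∀ x ∈ Cbar, ∀ y ∈ Cbar, x + y = 0 → x = 0 ∧ y = 0) (χ : G → G → ℤ) (l u : Λˣ)
    {a b : ℕ} (κ : Fin a → Cpos Cbar) (lam : Fin b → Cpos Cbar) :
    ∑ m ∈ candidatesB hC κ lam,
      coeff614 χ l u κ lam (repF m) * ((u⁻¹ ^ Multiset.card m : Λˣ) : Λ) =
    ((u⁻¹ ^ a : Λˣ) : Λ) * ((u⁻¹ ^ b : Λˣ) : Λ) *
      ∏ q : Fin a × Fin b, ((l ^ (-χ ((lam q.2 : G)) ((κ q.1 : G))) : Λˣ) : Λ) := by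
  have hpow (c : ℕ) : ((u ^ ((c : ℤ) - (a : ℤ) - (b : ℤ)) : Λˣ) : Λ) * ((u⁻¹ ^ c : Λˣ) : Λ) =
      ((u⁻¹ ^ a : Λˣ) : Λ) * ((u⁻¹ ^ b : Λˣ) : Λ) := by
    rw [← Units.val_mul, ← Units.val_mul]
    congr 1
    simp only [zpow_sub, zpow_natCast, inv_pow]
    rw [mul_right_comm, mul_right_comm (u ^ c), mul_inv_cancel, one_mul]
  let H (c : ℕ) (m : Multiset (Cpos Cbar)) : Λ := ∑ n ∈ Finset.range (a + b + 1),
    algebraMap ℚ Λ ((-1 : ℚ) ^ (n + c) / (n.factorial : ℚ) / (c.factorial : ℚ)) *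
      ∑ t : (Fin a → Fin n) × (Fin b → Fin n) × (Fin n → Fin c),
        if Multiset.map (tripleClass κ lam t) Finset.univ.val =
            m.map (Subtype.val : Cpos Cbar → G) then
          tripleWeight χ l κ lam t else 0
  have hterm (m : Multiset (Cpos Cbar)) (hm : m ∈ candidatesB hC κ lam) :
      coeff614 χ l u κ lam (repF m) * ((u⁻¹ ^ Multiset.card m : Λˣ) : Λ) =
      ((u⁻¹ ^ a : Λˣ) : Λ) * ((u⁻¹ ^ b : Λˣ) : Λ) *
        ∑ c ∈ Finset.range (a + b + 1), H c m := by
    rw [coeff614_repF, mul_right_comm, hpow]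
    congr 1
    symm
    refine Finset.sum_eq_single_of_mem m.card
      (Finset.mem_range.mpr (Nat.lt_succ_of_le (card_le_of_mem_candidatesB hC hm)))
      fun c _ hc => Finset.sum_eq_zero fun n _ => ?_
    rw [Finset.sum_eq_zero, mul_zero]
    intro t _
    rw [if_neg]
    intro h
    exact hc (by simpa using congrArg Multiset.card h)
  rw [Finset.sum_congr rfl hterm, ← Finset.mul_sum, Finset.sum_comm, ← sum_coefficients]
  congr 1
  refine Finset.sum_congr rfl fun c _ => ?_
  rw [Finset.sum_comm]
  refine Finset.sum_congr rfl fun n _ => ?_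
  rw [← Finset.mul_sum, Finset.sum_comm]
  congr 1
  exact Finset.sum_congr rfl fun t _ => sum_candidatesB hC χ l κ lam t

theorem deltaMap_add {R : Type} [CommRing R] {Cbar : AddSubmonoid G} (u : Rˣ)
    (f g : Multiset (Cpos Cbar) →₀ R) :
    deltaMap u (f + g) = deltaMap u f + deltaMap u g :=
  Finsupp.sum_add_index' (by simp) (by simp [add_mul])

theorem deltaMap_smul {R : Type} [CommRing R] {Cbar : AddSubmonoid G} (u : Rˣ) (c : R)
    (f : Multiset (Cpos Cbar) →₀ R) : deltaMap u (c • f) = c • deltaMap u f := by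
  rw [deltaMap, deltaMap, Finsupp.sum_smul_index' (by simp), Finsupp.smul_sum]
  exact Finsupp.sum_congr fun m _ => by
    rw [Finsupp.smul_single, smul_eq_mul, smul_eq_mul, mul_assoc]

theorem deltaMap_zero {R : Type} [CommRing R] {Cbar : AddSubmonoid G} (u : Rˣ) :
    deltaMap u (0 : Multiset (Cpos Cbar) →₀ R) = 0 := Finsupp.sum_zero_index

theorem deltaMap_single {R : Type} [CommRing R] {Cbar : AddSubmonoid G} (u : Rˣ)
    (m : Multiset (Cpos Cbar)) (x : R) :
    deltaMap u (Finsupp.single m x) =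
      Finsupp.single (sumCbar m) (x * ((u⁻¹ ^ Multiset.card m : Rˣ) : R)) :=
  Finsupp.sum_single_index (by simp)

theorem deltaMap_sum {R : Type} [CommRing R] {Cbar : AddSubmonoid G} {ι : Type} (u : Rˣ)
    (s : Finset ι)
    (f : ι → Multiset (Cpos Cbar) →₀ R) :
    deltaMap u (∑ i ∈ s, f i) = ∑ i ∈ s, deltaMap u (f i) :=
  map_sum (⟨⟨deltaMap u, deltaMap_zero u⟩, deltaMap_add u⟩ :
    (Multiset (Cpos Cbar) →₀ R) →+ (↥Cbar →₀ R)) f s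

theorem mulA_add_left {R : Type} [CommRing R] (Cbar : AddSubmonoid G) (χ : G → G → ℤ) (l : Rˣ)
    (f f' g : ↥Cbar →₀ R) :
    mulA Cbar χ l (f + f') g = mulA Cbar χ l f g + mulA Cbar χ l f' g :=
  Finsupp.sum_add_index' (by simp) (by simp [add_mul, Finsupp.sum_add])

theorem mulA_add_right {R : Type} [CommRing R] (Cbar : AddSubmonoid G) (χ : G → G → ℤ) (l : Rˣ)
    (f g g' : ↥Cbar →₀ R) :
    mulA Cbar χ l f (g + g') = mulA Cbar χ l f g + mulA Cbar χ l f g' := by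
  rw [mulA, mulA, mulA, ← Finsupp.sum_add]
  exact Finsupp.sum_congr fun α _ =>
    Finsupp.sum_add_index' (by simp) (by simp [add_mul, mul_add])

theorem mulA_zero_left {R : Type} [CommRing R] (Cbar : AddSubmonoid G) (χ : G → G → ℤ) (l : Rˣ)
    (g : ↥Cbar →₀ R) :
    mulA Cbar χ l 0 g = 0 := Finsupp.sum_zero_index

theorem mulA_zero_right {R : Type} [CommRing R] (Cbar : AddSubmonoid G) (χ : G → G → ℤ) (l : Rˣ)
    (f : ↥Cbar →₀ R) :
    mulA Cbar χ l f 0 = 0 := by simp [mulA]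

theorem mulA_single {R : Type} [CommRing R] (Cbar : AddSubmonoid G) (χ : G → G → ℤ) (l : Rˣ)
    (α β : ↥Cbar) (x y : R) :
    mulA Cbar χ l (Finsupp.single α x) (Finsupp.single β y) =
      Finsupp.single (α + β) (x * y * ((l ^ (-χ (β : G) (α : G)) : Rˣ) : R)) := by
  rw [mulA, Finsupp.sum_single_index (by simp), Finsupp.sum_single_index (by simp)]

section mulB

variable {Cbar : AddSubmonoid G} (χ : G → G → ℤ) (l u : Λˣ)
  (hC : ∀ x ∈ Cbar, ∀ y ∈ Cbar, x + y = 0 → x = 0 ∧ y = 0)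

theorem mulB_add_left (f f' g : Multiset (Cpos Cbar) →₀ Λ) :
    mulB χ l u hC (f + f') g = mulB χ l u hC f g + mulB χ l u hC f' g :=
  Finsupp.sum_add_index' (by simp) (by simp [add_mul, Finsupp.sum_add, Finset.sum_add_distrib])

theorem mulB_add_right (f g g' : Multiset (Cpos Cbar) →₀ Λ) :
    mulB χ l u hC f (g + g') = mulB χ l u hC f g + mulB χ l u hC f g' := by
  rw [mulB, mulB, mulB, ← Finsupp.sum_add]
  exact Finsupp.sum_congr fun α _ =>
    Finsupp.sum_add_index' (by simp) (by simp [add_mul, mul_add, Finset.sum_add_distrib])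

theorem mulB_zero_left (g : Multiset (Cpos Cbar) →₀ Λ) : mulB χ l u hC 0 g = 0 :=
  Finsupp.sum_zero_index

theorem mulB_zero_right (f : Multiset (Cpos Cbar) →₀ Λ) : mulB χ l u hC f 0 = 0 := by
  simp [mulB]

theorem mulB_single (m₁ m₂ : Multiset (Cpos Cbar)) (x y : Λ) :
    mulB χ l u hC (Finsupp.single m₁ x) (Finsupp.single m₂ y) =
      ∑ m₃ ∈ candidatesB hC (repF m₁) (repF m₂),
        Finsupp.single m₃ (x * y * coeff614 χ l u (repF m₁) (repF m₂) (repF m₃)) := by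
  rw [mulB, Finsupp.sum_single_index (by simp), Finsupp.sum_single_index (by simp)]

end mulB

theorem coe_sumCbar {Cbar : AddSubmonoid G} (m : Multiset (Cpos Cbar)) :
    (sumCbar m : G) = ∑ k, (repF m k : G) := by
  change (m.map (Subtype.val : Cpos Cbar → G)).sum = _
  rw [← map_val_repF]
  rfl

theorem sumCbar_of_mem_candidatesB {Cbar : AddSubmonoid G}
    (hC : ∀ x ∈ Cbar, ∀ y ∈ Cbar, x + y = 0 → x = 0 ∧ y = 0)
    {m₁ m₂ m₃ : Multiset (Cpos Cbar)} (h : m₃ ∈ candidatesB hC (repF m₁) (repF m₂)) :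
    sumCbar m₃ = sumCbar m₁ + sumCbar m₂ := by
  obtain ⟨c, ρ, hρ, rfl⟩ := (mem_candidatesB hC).mp h
  apply Subtype.ext
  rw [AddSubmonoid.coe_add, coe_sumCbar m₁, coe_sumCbar m₂]
  simp only [sumCbar, Multiset.map_map]
  change ∑ k, (targetμ hC (repF m₁) (repF m₂) hρ k : G) = _
  simp only [targetμ, Finset.sum_fiberwise, Fintype.sum_sum_type, Sum.elim_inl, Sum.elim_inr]

theorem prod_zpow_neg_biadditive {R ι ι' : Type} [CommRing R] [Fintype ι] [Fintype ι']
    (χ : G → G → ℤ)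
    (hχ₁ : ∀ x y z : G, χ (x + y) z = χ x z + χ y z)
    (hχ₂ : ∀ x y z : G, χ x (y + z) = χ x y + χ x z) (l : Rˣ) (f : ι → G) (g : ι' → G) :
    ∏ q : ι × ι', ((l ^ (-χ (g q.2) (f q.1)) : Rˣ) : R) =
      ((l ^ (-χ (∑ j, g j) (∑ i, f i)) : Rˣ) : R) := by
  let X : G →+ G →+ ℤ := AddMonoidHom.mk' (fun x => AddMonoidHom.mk' (χ x) (hχ₂ x))
    (fun x y => AddMonoidHom.ext (hχ₁ x y))
  have hX : χ (∑ j, g j) (∑ i, f i) = ∑ i, ∑ j, χ (g j) (f i) := by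
    change X _ _ = _
    rw [map_sum X, AddMonoidHom.finsetSum_apply, Finset.sum_comm]
    exact Finset.sum_congr rfl fun j _ => map_sum (X (g j)) f _
  rw [hX, ← Fintype.sum_prod_type', ← Finset.sum_neg_distrib, ← Units.coe_prod]
  congr 1
  exact (map_sum (zmultiplesHom (Additive Rˣ) (Additive.ofMul l)) _ _).symm

theorem deltaMap_mulB_single {Cbar : AddSubmonoid G}
    (hC : ∀ x ∈ Cbar, ∀ y ∈ Cbar, x + y = 0 → x = 0 ∧ y = 0) (χ : G → G → ℤ)
    (hχ₁ : ∀ x y z : G, χ (x + y) z = χ x z + χ y z)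
    (hχ₂ : ∀ x y z : G, χ x (y + z) = χ x y + χ x z) (l u : Λˣ)
    (m₁ m₂ : Multiset (Cpos Cbar)) (x y : Λ) :
    deltaMap u (mulB χ l u hC (Finsupp.single m₁ x) (Finsupp.single m₂ y)) =
      mulA Cbar χ l (deltaMap u (Finsupp.single m₁ x)) (deltaMap u (Finsupp.single m₂ y)) := by
  rw [mulB_single, deltaMap_sum, deltaMap_single, deltaMap_single, mulA_single]
  have hterm (m₃ : Multiset (Cpos Cbar)) (h : m₃ ∈ candidatesB hC (repF m₁) (repF m₂)) :
      deltaMap u (Finsupp.single m₃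
        (x * y * coeff614 χ l u (repF m₁) (repF m₂) (repF m₃))) =
      Finsupp.single (sumCbar m₁ + sumCbar m₂) (x * y *
        (coeff614 χ l u (repF m₁) (repF m₂) (repF m₃) *
          ((u⁻¹ ^ Multiset.card m₃ : Λˣ) : Λ))) := by
    rw [deltaMap_single, sumCbar_of_mem_candidatesB hC h, mul_assoc]
  rw [Finset.sum_congr rfl hterm, ← Finsupp.single_finsetSum, ← Finset.mul_sum,
    sum_coeff614,
    prod_zpow_neg_biadditive χ hχ₁ hχ₂ l (fun i => (repF m₁ i : G)) (fun j => (repF m₂ j : G)),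
    ← coe_sumCbar, ← coe_sumCbar]
  congr 1
  ring

theorem statement17
    (Cbar : AddSubmonoid G)
    (hC : ∀ x ∈ Cbar, ∀ y ∈ Cbar, x + y = 0 → x = 0 ∧ y = 0)
    (χ : G → G → ℤ)
    (hχ₁ : ∀ x y z : G, χ (x + y) z = χ x z + χ y z)
    (hχ₂ : ∀ x y z : G, χ x (y + z) = χ x y + χ x z)
    (l u : Λˣ) (hl : ∀ k : ℕ, 0 < k → IsUnit ((l : Λ) ^ k - 1))
    (hu : (u : Λ) = (l : Λ) - 1) :
    (∀ f g : Multiset (Cpos Cbar) →₀ Λ, deltaMap u (f + g) = deltaMap u f + deltaMap u g) ∧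
    (∀ (c : Λ) (f : Multiset (Cpos Cbar) →₀ Λ), deltaMap u (c • f) = c • deltaMap u f) ∧
    deltaMap (Cbar := Cbar) u (Finsupp.single 0 1) = Finsupp.single 0 1 ∧
    (∀ f g : Multiset (Cpos Cbar) →₀ Λ,
      deltaMap u (mulB χ l u hC f g) = mulA Cbar χ l (deltaMap u f) (deltaMap u g)) := by
  refine ⟨deltaMap_add u, deltaMap_smul u, ?_, fun f g => ?_⟩
  · rw [deltaMap_single]
    simp [sumCbar]
    rfl
  · induction f using Finsupp.induction_linear with
    | zero => rw [mulB_zero_left, deltaMap_zero, mulA_zero_left]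
    | add f f' hf hf' =>
      rw [mulB_add_left, deltaMap_add, deltaMap_add, mulA_add_left, hf, hf']
    | single m₁ x =>
      induction g using Finsupp.induction_linear with
      | zero => rw [mulB_zero_right, deltaMap_zero, mulA_zero_right]
      | add g g' hg hg' =>
        rw [mulB_add_right, deltaMap_add, deltaMap_add, mulA_add_right, hg, hg']
      | single m₂ y => exact deltaMap_mulB_single hC χ hχ₁ hχ₂ l u m₁ m₂ x y

end
end

section
/- Suppose ℘ ∈ Λ satisfies ℘² = ℓ; then ℘ and ℘ − ℘^{−1} are invertible in Λ. For α ∈ C(𝒜) set b̃^α = ℘^{1−χ(α,α)} b^α in B(𝒜,Λ,χ). Then for all α, β ∈ C(𝒜) the commutator satisfies [b̃^α, b̃^β] = b̃^α ⋆ b̃^β − b̃^β ⋆ b̃^α = ((℘^{χ(α,β)−χ(β,α)} − ℘^{χ(β,α)−χ(α,β)})/(℘ − ℘^{−1})) b̃^{α+β}; in particular the coefficient depends only on the antisymmetrization (α,β) ↦ χ(α,β) − χ(β,α) of χ and is unchanged by replacing ℘ with ℘^{−1}. -/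
open Classical Function

noncomputable section

variable {G : Type} [AddCommGroup G] {Λ : Type} [CommRing Λ] [Algebra ℚ Λ]
  {Ω : Type} [CommRing Ω] [Algebra ℚ Ω]

theorem coeff614_congr {Cbar : AddSubmonoid G} (χ : G → G → ℤ) (l u : Λˣ) {a b c a' b' c' : ℕ}
    {κ : Fin a → Cpos Cbar} {lam : Fin b → Cpos Cbar} {μ : Fin c → Cpos Cbar}
    {κ' : Fin a' → Cpos Cbar} {lam' : Fin b' → Cpos Cbar} {μ' : Fin c' → Cpos Cbar}
    (ha : a = a') (hb : b = b') (hc : c = c') (hκ : ∀ i, κ i = κ' (Fin.cast ha i))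
    (hlam : ∀ i, lam i = lam' (Fin.cast hb i)) (hμ : ∀ i, μ i = μ' (Fin.cast hc i)) :
    coeff614 χ l u κ lam μ = coeff614 χ l u κ' lam' μ' := by
  subst ha hb hc
  obtain rfl : κ = κ' := funext hκ
  obtain rfl : lam = lam' := funext hlam
  obtain rfl : μ = μ' := funext hμ
  rfl

theorem candidatesB_congr {Cbar : AddSubmonoid G}
    (hC : ∀ x ∈ Cbar, ∀ y ∈ Cbar, x + y = 0 → x = 0 ∧ y = 0) {a b a' b' : ℕ}
    {κ : Fin a → Cpos Cbar} {lam : Fin b → Cpos Cbar}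
    {κ' : Fin a' → Cpos Cbar} {lam' : Fin b' → Cpos Cbar}
    (ha : a = a') (hb : b = b') (hκ : ∀ i, κ i = κ' (Fin.cast ha i))
    (hlam : ∀ i, lam i = lam' (Fin.cast hb i)) :
    candidatesB hC κ lam = candidatesB hC κ' lam' := by
  subst ha hb
  obtain rfl : κ = κ' := funext hκ
  obtain rfl : lam = lam' := funext hlam
  rfl

theorem repF_singleton {Cbar : AddSubmonoid G} (α : Cpos Cbar)
    (i : Fin (Multiset.card ({α} : Multiset (Cpos Cbar)))) : repF {α} i = α := by
  have h : repF {α} i ∈ (({α} : Multiset (Cpos Cbar))).toList := List.get_mem _ _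
  simpa using h

theorem addC_comm {Cbar : AddSubmonoid G}
    (hC : ∀ x ∈ Cbar, ∀ y ∈ Cbar, x + y = 0 → x = 0 ∧ y = 0) (α β : Cpos Cbar) :
    addC hC α β = addC hC β α :=
  Subtype.ext (add_comm (α : G) (β : G))

theorem pair_mem_candidatesB {Cbar : AddSubmonoid G}
    (hC : ∀ x ∈ Cbar, ∀ y ∈ Cbar, x + y = 0 → x = 0 ∧ y = 0) (α β : Cpos Cbar) :
    ({α, β} : Multiset (Cpos Cbar)) ∈
      candidatesB hC (fun _ : Fin 1 => α) (fun _ : Fin 1 => β) := by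
  refine Finset.mem_biUnion.2 ⟨2, by simp, Finset.mem_image.2
    ⟨⟨Sum.elim (fun _ => 0) (fun _ => 1), ?_⟩, Finset.mem_univ _, ?_⟩⟩
  · intro k
    fin_cases k
    · exact ⟨Sum.inl 0, rfl⟩
    · exact ⟨Sum.inr 0, rfl⟩
  · have h0 : ∀ h, targetμ hC (fun _ : Fin 1 => α) (fun _ : Fin 1 => β)
        (ρ := Sum.elim (fun _ => (0 : Fin 2)) (fun _ => 1)) h 0 = α := by
      intro h
      apply Subtype.ext
      simp [targetμ, Finset.sum_filter]
    have h1 : ∀ h, targetμ hC (fun _ : Fin 1 => α) (fun _ : Fin 1 => β)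
        (ρ := Sum.elim (fun _ => (0 : Fin 2)) (fun _ => 1)) h 1 = β := by
      intro h
      apply Subtype.ext
      simp [targetμ, Finset.sum_filter]
    simp only [Fin.univ_val_map, List.ofFn_succ, List.ofFn_zero]
    simp only [Fin.succ_zero_eq_one, h0, h1]
    rfl

theorem candidatesB_one_one {Cbar : AddSubmonoid G}
    (hC : ∀ x ∈ Cbar, ∀ y ∈ Cbar, x + y = 0 → x = 0 ∧ y = 0) (α β : Cpos Cbar) :
    candidatesB hC (fun _ : Fin 1 => α) (fun _ : Fin 1 => β) = {{addC hC α β}, {α, β}} := by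
  apply Finset.Subset.antisymm
  · intro m hm
    obtain ⟨c, hc, hm⟩ := Finset.mem_biUnion.1 hm
    obtain ⟨⟨ρ, hρ⟩, -, rfl⟩ := Finset.mem_image.1 hm
    have hc : c < 3 := by simpa using hc
    interval_cases c
    · exact (ρ (Sum.inl 0)).elim0
    · rw [Finset.mem_insert]
      left
      have h0 : targetμ hC (fun _ : Fin 1 => α) (fun _ : Fin 1 => β) hρ 0 = addC hC α β := by
        apply Subtype.ext
        simp [targetμ, addC, Subsingleton.elim _ (0 : Fin 1)]
      simp only [Fin.univ_val_map, List.ofFn_succ, List.ofFn_zero, h0]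
      rfl
    · rw [Finset.mem_insert, Finset.mem_singleton]
      right
      have key : ∀ k, (targetμ hC (fun _ : Fin 1 => α) (fun _ : Fin 1 => β) hρ k : G)
          = (if ρ (Sum.inl 0) = k then (α : G) else 0) + if ρ (Sum.inr 0) = k then (β : G) else 0 := by
        intro k
        simp [targetμ, Finset.sum_filter]
      obtain ⟨x, hx⟩ := hρ 0
      obtain ⟨y, hy⟩ := hρ 1
      simp only [Fin.univ_val_map, List.ofFn_succ, List.ofFn_zero, Fin.succ_zero_eq_one]
      rcases x with x | x <;> rcases y with y | y <;>
        obtain rfl := Subsingleton.elim 0 x <;> obtain rfl := Subsingleton.elim 0 y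
      · simp [hx] at hy
      · rw [show targetμ hC _ _ hρ 0 = α from Subtype.ext (by simp [key, hx, hy]),
          show targetμ hC _ _ hρ 1 = β from Subtype.ext (by simp [key, hx, hy])]
        rfl
      · rw [show targetμ hC _ _ hρ 0 = β from Subtype.ext (by simp [key, hx, hy]),
          show targetμ hC _ _ hρ 1 = α from Subtype.ext (by simp [key, hx, hy])]
        exact Multiset.pair_comm β α
      · simp [hx] at hy
  · intro m hm
    rcases Finset.mem_insert.1 hm with rfl | hm
    · refine Finset.mem_biUnion.2 ⟨1, by simp, Finset.mem_image.2
        ⟨⟨fun _ => 0, fun k => ⟨Sum.inl 0, Subsingleton.elim _ _⟩⟩, Finset.mem_univ _, ?_⟩⟩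
      simp only [Fin.univ_val_map, List.ofFn_succ, List.ofFn_zero]
      refine congrArg (fun x => ({x} : Multiset (Cpos Cbar))) (Subtype.ext ?_)
      simp [targetμ, addC]
    · obtain rfl := Finset.mem_singleton.1 hm
      exact pair_mem_candidatesB hC α β

theorem autCard_of_subsingleton {Cbar : AddSubmonoid G} (μ : Fin 1 → Cpos Cbar) :
    autCard μ = 1 := by
  rw [autCard, Nat.card_eq_one_iff_unique]
  exact ⟨inferInstance, ⟨⟨1, rfl⟩⟩⟩

/-- The coefficient of `b^{α+β}` in `b^α ⋆ b^β`. -/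
theorem coeff614_add {Cbar : AddSubmonoid G}
    (hC : ∀ x ∈ Cbar, ∀ y ∈ Cbar, x + y = 0 → x = 0 ∧ y = 0) (χ : G → G → ℤ) (l u : Λˣ)
    (α β : Cpos Cbar) :
    coeff614 χ l u (fun _ : Fin 1 => α) (fun _ : Fin 1 => β) (fun _ : Fin 1 => addC hC α β) =
      ((u⁻¹ : Λˣ) : Λ) * (((l ^ (-χ (β : G) (α : G)) : Λˣ) : Λ) - 1) := by
  have hsum : ∀ (n : ℕ) (F : (Fin 1 → Fin n) × (Fin 1 → Fin n) × (Fin n → Fin 1) → Λ),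
      ∑ t, F t = ∑ i, ∑ j, F (fun _ => i, fun _ => j, fun _ => 0) := by
    intro n F
    rw [Fintype.sum_prod_type, ← (Equiv.funUnique (Fin 1) (Fin n)).symm.sum_comp]
    refine Finset.sum_congr rfl fun i _ => ?_
    rw [Fintype.sum_prod_type, ← (Equiv.funUnique (Fin 1) (Fin n)).symm.sum_comp]
    refine Finset.sum_congr rfl fun j _ => ?_
    rw [Fintype.sum_unique]
    rfl
  have hsurj : ∀ i j : Fin 2, Function.Surjective
      (Sum.elim (fun _ : Fin 1 => i) (fun _ : Fin 1 => j)) ↔ i ≠ j := by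
    intro i j
    simp only [Function.Surjective, Sum.exists, Sum.elim_inl, Sum.elim_inr, exists_const]
    revert i j
    decide
  have hprod : ∀ {n : ℕ} (i j : Fin n), (∏ q ∈ Finset.univ.filter
      (fun q : Fin 1 × Fin 1 => i = j), ((l ^ (-χ (β : G) (α : G)) : Λˣ) : Λ)) =
      if i = j then ((l ^ (-χ (β : G) (α : G)) : Λˣ) : Λ) else 1 := by
    intro n i j
    split_ifs with h <;> simp [h]
  have hhalf : algebraMap ℚ Λ ((-1) ^ 3 / 2) * 2 = -1 := by
    rw [← map_ofNat (algebraMap ℚ Λ) 2, ← map_mul]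
    norm_num
  rw [coeff614, autCard_of_subsingleton]
  simp only [Finset.sum_filter, hsum, Finset.sum_range_succ, Finset.sum_range_zero,
    Fin.sum_univ_zero, Fin.sum_univ_one, hsurj, hprod]
  simp [Function.surjective_to_subsingleton, addC]
  linear_combination hhalf

/-- The coefficients of the two-element classes in `b^α ⋆ b^β` and `b^β ⋆ b^α` agree. -/
theorem coeff614_comm_of_two {Cbar : AddSubmonoid G} (χ : G → G → ℤ) (l u : Λˣ)
    (α β : Cpos Cbar) {c : ℕ} (hc : c = 2) (μ : Fin c → Cpos Cbar) :
    coeff614 χ l u (fun _ : Fin 1 => α) (fun _ : Fin 1 => β) μ =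
      coeff614 χ l u (fun _ : Fin 1 => β) (fun _ : Fin 1 => α) μ := by
  subst hc
  unfold coeff614
  congr 1
  refine Finset.sum_congr rfl fun n _ => ?_
  congr 1
  let e : (Fin 1 → Fin n) × (Fin 1 → Fin n) × (Fin n → Fin 2) ≃
      (Fin 1 → Fin n) × (Fin 1 → Fin n) × (Fin n → Fin 2) :=
    { toFun := fun t => (t.2.1, t.1, t.2.2)
      invFun := fun t => (t.2.1, t.1, t.2.2)
      left_inv := fun _ => rfl
      right_inv := fun _ => rfl }
  have hswap : ∀ f g : Fin 1 → Fin n, Function.Surjective (Sum.elim f g) →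
      Function.Surjective (Sum.elim g f) := by
    intro f g h k
    obtain ⟨x | x, hx⟩ := h k
    exacts [⟨Sum.inr x, hx⟩, ⟨Sum.inl x, hx⟩]
  have hne : ∀ (f g : Fin 1 → Fin n) (θ : Fin n → Fin 2), Function.Surjective (Sum.elim f g) →
      Function.Surjective θ → ∀ i j, f i ≠ g j := by
    intro f g θ h hθ i j hij
    have hall : ∀ k, θ k = θ (f i) := by
      intro k
      obtain ⟨x | x, rfl⟩ := h k
      · rw [Subsingleton.elim x i]; rfl
      · rw [Subsingleton.elim x j, hij]; rfl
    obtain ⟨x, hx⟩ := hθ 0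
    obtain ⟨y, hy⟩ := hθ 1
    rw [hall] at hx hy
    exact absurd (hx.symm.trans hy) (by decide)
  refine Finset.sum_equiv e ?_ ?_
  · intro t
    simp only [Finset.mem_filter, Finset.mem_univ, true_and, e, Equiv.coe_fn_mk]
    exact and_congr ⟨hswap _ _, hswap _ _⟩
      (and_congr Iff.rfl (forall_congr' fun k => by rw [add_comm]))
  · intro t ht
    obtain ⟨-, h1, h2, -⟩ := Finset.mem_filter.1 ht
    congr 1
    rw [Finset.filter_false_of_mem fun q _ => hne _ _ _ h1 h2 q.1 q.2,
      Finset.filter_false_of_mem fun q _ => hne _ _ _ (hswap _ _ h1) h2 q.1 q.2,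
      Finset.prod_empty, Finset.prod_empty]

/-- The product of two generators `b^α`, `b^β`, up to the coefficient of `b_{[α,β]}`. -/
theorem mulB_single_single {Cbar : AddSubmonoid G} (χ : G → G → ℤ) (l u : Λˣ)
    (hC : ∀ x ∈ Cbar, ∀ y ∈ Cbar, x + y = 0 → x = 0 ∧ y = 0) (α β : Cpos Cbar) (x y : Λ) :
    mulB χ l u hC (Finsupp.single {α} x) (Finsupp.single {β} y) =
      Finsupp.single {addC hC α β}
        (x * y * (((u⁻¹ : Λˣ) : Λ) * (((l ^ (-χ (β : G) (α : G)) : Λˣ) : Λ) - 1))) +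
      Finsupp.single {α, β} (x * y * coeff614 χ l u (fun _ : Fin 1 => α) (fun _ : Fin 1 => β)
        (repF {α, β})) := by
  have hcoeff : ∀ {c : ℕ} (μ : Fin c → Cpos Cbar), coeff614 χ l u (repF {α}) (repF {β}) μ =
      coeff614 χ l u (fun _ : Fin 1 => α) (fun _ : Fin 1 => β) μ := fun μ =>
    coeff614_congr χ l u (Multiset.card_singleton _) (Multiset.card_singleton _) rfl
      (repF_singleton α) (repF_singleton β) fun _ => rfl
  have hadd : coeff614 χ l u (fun _ : Fin 1 => α) (fun _ : Fin 1 => β)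
      (repF {addC hC α β}) = _ :=
    (coeff614_congr χ l u rfl rfl (Multiset.card_singleton _) (fun _ => rfl) (fun _ => rfl)
      (repF_singleton _)).trans (coeff614_add hC χ l u α β)
  have hcand : candidatesB hC (repF {α}) (repF {β}) = {{addC hC α β}, {α, β}} :=
    (candidatesB_congr hC (Multiset.card_singleton _) (Multiset.card_singleton _)
      (repF_singleton α) (repF_singleton β)).trans (candidatesB_one_one hC α β)
  have hne : ({addC hC α β} : Multiset (Cpos Cbar)) ∉
      ({{α, β}} : Finset (Multiset (Cpos Cbar))) := by
    rw [Finset.mem_singleton]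
    intro h
    simpa using congrArg Multiset.card h
  rw [mulB, Finsupp.sum_single_index, Finsupp.sum_single_index, hcand, Finset.sum_insert hne,
    Finset.sum_singleton, hcoeff, hcoeff, hadd]
  · simp
  · simp [Finsupp.sum]

theorem statement18
    (Cbar : AddSubmonoid G)
    (hC : ∀ x ∈ Cbar, ∀ y ∈ Cbar, x + y = 0 → x = 0 ∧ y = 0)
    (χ : G → G → ℤ)
    (hχ₁ : ∀ x y z : G, χ (x + y) z = χ x z + χ y z)
    (hχ₂ : ∀ x y z : G, χ x (y + z) = χ x y + χ x z)
    (l u : Λˣ) (hl : ∀ k : ℕ, 0 < k → IsUnit ((l : Λ) ^ k - 1))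
    (hu : (u : Λ) = (l : Λ) - 1)
    (p : Λ) (hp : p ^ 2 = (l : Λ)) :
    IsUnit p ∧
    ∀ P : Λˣ, (P : Λ) = p →
      IsUnit ((P : Λ) - ((P⁻¹ : Λˣ) : Λ)) ∧
      ∀ W : Λˣ, (W : Λ) = (P : Λ) - ((P⁻¹ : Λˣ) : Λ) →
        (∀ α β : Cpos Cbar,
          mulB χ l u hC
              (Finsupp.single {α} ((P ^ (1 - χ (α : G) (α : G)) : Λˣ) : Λ))
              (Finsupp.single {β} ((P ^ (1 - χ (β : G) (β : G)) : Λˣ) : Λ))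
            - mulB χ l u hC
              (Finsupp.single {β} ((P ^ (1 - χ (β : G) (β : G)) : Λˣ) : Λ))
              (Finsupp.single {α} ((P ^ (1 - χ (α : G) (α : G)) : Λˣ) : Λ))
          = ((((P ^ (χ (α : G) (β : G) - χ (β : G) (α : G)) : Λˣ) : Λ)
                - ((P ^ (χ (β : G) (α : G) - χ (α : G) (β : G)) : Λˣ) : Λ)) * ((W⁻¹ : Λˣ) : Λ)) •
              Finsupp.single {addC hC α β}
                ((P ^ (1 - χ ((addC hC α β : G)) ((addC hC α β : G))) : Λˣ) : Λ)) ∧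
        (∀ α β : Cpos Cbar,
          ((((P ^ (χ (α : G) (β : G) - χ (β : G) (α : G)) : Λˣ) : Λ)
              - ((P ^ (χ (β : G) (α : G) - χ (α : G) (β : G)) : Λˣ) : Λ)) * ((W⁻¹ : Λˣ) : Λ))
            = ((((P⁻¹ ^ (χ (α : G) (β : G) - χ (β : G) (α : G)) : Λˣ) : Λ)
                - ((P⁻¹ ^ (χ (β : G) (α : G) - χ (α : G) (β : G)) : Λˣ) : Λ))
                  * (((-W)⁻¹ : Λˣ) : Λ))) := by
  have hpp : IsUnit p := by
    have h : IsUnit (p ^ 2) := hp ▸ l.isUnit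
    exact (isUnit_pow_iff two_ne_zero).1 h
  refine ⟨hpp, fun P hP => ?_⟩
  have hlP : l = P ^ 2 := Units.ext (by rw [Units.val_pow_eq_pow_val, hP, hp])
  have huP : (u : Λ) = P * ((P : Λ) - ((P⁻¹ : Λˣ) : Λ)) := by
    rw [hu, hlP, mul_sub, Units.mul_inv, Units.val_pow_eq_pow_val, sq]
  refine ⟨isUnit_of_mul_isUnit_right (huP ▸ u.isUnit), fun W hW => ⟨fun α β => ?_, fun α β => ?_⟩⟩
  · have huW : u = P * W := Units.ext (by rw [huP, Units.val_mul, hW])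
    have hpair : ({β, α} : Multiset (Cpos Cbar)) = {α, β} := Multiset.pair_comm β α
    rw [mulB_single_single, mulB_single_single, hpair, addC_comm hC β α,
      coeff614_comm_of_two χ l u β α (Multiset.card_pair α β), Finsupp.smul_single, smul_eq_mul]
    rw [mul_comm ((P ^ (1 - χ (β : G) (β : G)) : Λˣ) : Λ), add_sub_add_right_eq_sub,
      ← Finsupp.single_sub]
    congr 1
    have hexp : χ (addC hC α β : G) (addC hC α β : G) =
        χ (α : G) α + χ (α : G) β + (χ (β : G) α + χ (β : G) β) := by
      simp only [addC, hχ₁, hχ₂]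
    have key : ∀ a b x y : ℤ, P ^ (1 - a) * P ^ (1 - b) * (u⁻¹ * l ^ (-y)) =
        P ^ (x - y) * W⁻¹ * P ^ (1 - (a + x + (y + b))) := by
      intro a b x y
      have h1 : P ^ (1 - a) * P ^ (1 - b) * (P⁻¹ * (P ^ 2) ^ (-y)) =
          P ^ (x - y) * P ^ (1 - (a + x + (y + b))) := by
        rw [← zpow_natCast P 2, ← zpow_mul, ← zpow_neg_one P]
        simp only [← zpow_add]
        congr 1
        push_cast
        ring
      rw [huW, hlP, mul_inv, mul_right_comm (P ^ (x - y)), ← h1]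
      simp only [mul_assoc, mul_comm, mul_left_comm]
    have k1 := congrArg (Units.val) (key (χ (α : G) α) (χ (β : G) β) (χ (α : G) β) (χ (β : G) α))
    have k2 := congrArg (Units.val) (key (χ (α : G) α) (χ (β : G) β) (χ (β : G) α) (χ (α : G) β))
    rw [show χ (α : G) α + χ (β : G) α + (χ (α : G) β + χ (β : G) β) =
      χ (α : G) α + χ (α : G) β + (χ (β : G) α + χ (β : G) β) by ring] at k2
    simp only [Units.val_mul] at k1 k2
    rw [hexp]
    linear_combination k1 - k2
  · rw [inv_zpow', inv_zpow', neg_sub, neg_sub, inv_neg, Units.val_neg]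
    ring

end
end

section
/- Each A_{I,K,φ} is a unital 𝕂-subalgebra of 𝕂^I, and conversely every unital 𝕂-subalgebra of 𝕂^I is equal to A_{I,K,φ} for some finite set K and some surjective map φ : I → K. -/
open Function

namespace Subalgebra

variable {𝕂 I : Type*} [Field 𝕂]

/-- The equivalence relation on `I` identifying the points that no function in `S` separates. -/
def inseparableSetoid (S : Subalgebra 𝕂 (I → 𝕂)) : Setoid I where
  r i j := ∀ f ∈ S, f i = f j
  iseqv := ⟨fun _ _ _ => rfl, fun h f hf => (h f hf).symm,
    fun h₁ h₂ f hf => (h₁ f hf).trans (h₂ f hf)⟩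

theorem exists_mem_eq_one_eq_zero {S : Subalgebra 𝕂 (I → 𝕂)} {i j : I}
    (h : ¬ S.inseparableSetoid i j) : ∃ f ∈ S, f i = 1 ∧ f j = 0 := by
  obtain ⟨g, hg, hne⟩ : ∃ g ∈ S, g i ≠ g j := by
    by_contra! hc
    exact h hc
  refine ⟨(g i - g j)⁻¹ • (g - algebraMap 𝕂 (I → 𝕂) (g j)),
    S.smul_mem (S.sub_mem hg (S.algebraMap_mem _)) _, ?_, ?_⟩
  · simp [inv_mul_cancel₀ (sub_ne_zero.mpr hne)]
  · simp

theorem exists_mem_indicator_class [Finite I] (S : Subalgebra 𝕂 (I → 𝕂)) (i : I) :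
    ∃ e ∈ S, (∀ j, S.inseparableSetoid i j → e j = 1) ∧
      ∀ j, ¬ S.inseparableSetoid i j → e j = 0 := by
  have := Fintype.ofFinite I
  have hf : ∀ j, ∃ f ∈ S, f i = 1 ∧ (¬ S.inseparableSetoid i j → f j = 0) := fun j => by
    by_cases h : S.inseparableSetoid i j
    · exact ⟨1, S.one_mem, rfl, fun h' => absurd h h'⟩
    · obtain ⟨f, hfS, hi, hj⟩ := exists_mem_eq_one_eq_zero h
      exact ⟨f, hfS, hi, fun _ => hj⟩
  choose f hfS hfi hfj using hf
  refine ⟨∏ j, f j, S.prod_mem fun j _ => hfS j, fun k hk => ?_, fun k hk => ?_⟩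
  · rw [Finset.prod_apply]
    exact Finset.prod_eq_one fun j _ => (hk _ (hfS j)).symm.trans (hfi j)
  · rw [Finset.prod_apply]
    exact Finset.prod_eq_zero (Finset.mem_univ k) (hfj k hk)

theorem mem_iff_forall_inseparable [Finite I] (S : Subalgebra 𝕂 (I → 𝕂)) (δ : I → 𝕂) :
    δ ∈ S ↔ ∀ i j, S.inseparableSetoid i j → δ i = δ j := by
  refine ⟨fun hδ i j h => h δ hδ, fun hδ => ?_⟩
  have := Fintype.ofFinite (Quotient S.inseparableSetoid)
  choose e heS he₁ he₀ using S.exists_mem_indicator_class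
  have key : δ = ∑ q : Quotient S.inseparableSetoid, δ q.out • e q.out := by
    ext k
    have hk : S.inseparableSetoid (Quotient.mk S.inseparableSetoid k).out k :=
      Quotient.mk_out k
    rw [Finset.sum_apply, Finset.sum_eq_single (Quotient.mk S.inseparableSetoid k)]
    · simp [he₁ _ _ hk, hδ _ _ hk]
    · intro q _ hq
      have : ¬ S.inseparableSetoid q.out k := fun h =>
        hq (q.out_eq.symm.trans (Quotient.sound h))
      simp [he₀ _ _ this]
    · simp
  rw [key]
  exact S.sum_mem fun q _ => S.smul_mem (heS _) _

/-- The subalgebra of the functions that are constant on the fibres of `φ`. -/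
def constantOnFibres (𝕂 : Type*) [Field 𝕂] {K : Type*} (φ : I → K) :
    Subalgebra 𝕂 (I → 𝕂) where
  carrier := {δ | ∀ i j, φ i = φ j → δ i = δ j}
  mul_mem' ha hb i j h := congrArg₂ (· * ·) (ha i j h) (hb i j h)
  add_mem' ha hb i j h := congrArg₂ (· + ·) (ha i j h) (hb i j h)
  algebraMap_mem' _ _ _ _ := rfl

end Subalgebra

/-- For an algebraically closed field `𝕂` and a finite set `I`, the subsets
`A_{I,K,φ} = {δ ∈ 𝕂^I : φ(i) = φ(j) ⟹ δ(i) = δ(j)}` attached to finite sets `K`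
(represented by `Fin n`) and surjective maps `φ : I → K` are exactly the unital
`𝕂`-subalgebras of `𝕂^I`. -/
theorem statement19 {𝕂 : Type} [Field 𝕂] [IsAlgClosed 𝕂] {I : Type} [Fintype I] :
    (∀ (n : ℕ) (φ : I → Fin n), Function.Surjective φ →
      ∃ S : Subalgebra 𝕂 (I → 𝕂),
        (S : Set (I → 𝕂)) = {δ : I → 𝕂 | ∀ i j : I, φ i = φ j → δ i = δ j}) ∧
    (∀ S : Subalgebra 𝕂 (I → 𝕂), ∃ (n : ℕ) (φ : I → Fin n), Function.Surjective φ ∧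
      (S : Set (I → 𝕂)) = {δ : I → 𝕂 | ∀ i j : I, φ i = φ j → δ i = δ j}) := by
  refine ⟨fun n φ _ => ⟨Subalgebra.constantOnFibres 𝕂 φ, rfl⟩, fun S => ?_⟩
  obtain ⟨n, ⟨e⟩⟩ := Finite.exists_equiv_fin (Quotient S.inseparableSetoid)
  refine ⟨n, fun i => e (Quotient.mk _ i), e.surjective.comp Quotient.mk_surjective, ?_⟩
  ext δ
  simp only [SetLike.mem_coe, Set.mem_ofPred_eq, e.injective.eq_iff, Quotient.eq]
  exact S.mem_iff_forall_inseparable δ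
end
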